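/- Let N ≥ 1 be a natural number. Then for every integer p ≥ 1, Σ_{n=0}^{p} (−1)^n · binom(p, n) / ( (N+n−1)_n · (N+2n)_{p−n} ) = 0, while for p = 0 the sum equals 1. -/

import Mathlib

/-- Pochhammer symbol `(x)_k = x (x+1) ⋯ (x+k-1)`, with `(x)_0 = 1`. -/
noncomputable def poch (x : ℝ) (k : ℕ) : ℝ := ∏ i ∈ Finset.range k, (x + i)

theorem poch_succ (x : ℝ) (k : ℕ) : poch x (k + 1) = poch x k * (x + k) :=
  Finset.prod_range_succ _ _

theorem poch_add (x : ℝ) (k l : ℕ) : poch x (k + l) = poch x k * poch (x + k) l := by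
  simp only [poch, Finset.prod_range_add, Nat.cast_add, add_assoc]

theorem poch_succ_left (x : ℝ) (k : ℕ) : poch x (k + 1) = x * poch (x + 1) k := by
  rw [add_comm, poch_add]
  simp [poch]

theorem poch_pos {x : ℝ} (hx : 0 < x) (k : ℕ) : 0 < poch x k :=
  Finset.prod_pos fun _ _ => by positivity

/-- The alternating sum telescopes: closed form of its partial sums when `p = q + 1`. -/
theorem sum_range_alternating_choose_div_poch (N : ℕ) (hN : 1 ≤ N) (q m : ℕ) (hm : m ≤ q + 1) :
    ∑ n ∈ Finset.range (m + 1),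
      (-1 : ℝ) ^ n * (Nat.choose (q + 1) n : ℝ) /
        (poch ((N : ℝ) + n - 1) n * poch ((N : ℝ) + 2 * n) (q + 1 - n)) =
      (-1) ^ m * (Nat.choose q m : ℝ) / poch ((N : ℝ) + m) (q + 1) := by
  induction m with
  | zero => simp [poch]
  | succ m ih =>
    rw [Finset.sum_range_succ, ih (by omega)]
    obtain ⟨r, rfl⟩ : ∃ r, q = m + r := ⟨q - m, by omega⟩
    have hN' : (0 : ℝ) < N := by exact_mod_cast hN
    have hx : (0 : ℝ) < N + m := by positivity
    have hchoose : ((m + r).choose (m + 1) : ℝ) * (m + 1) = (m + r).choose m * r := by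
      have h := Nat.choose_succ_right_eq (m + r) m
      rw [Nat.add_sub_cancel_left] at h
      exact_mod_cast h
    have hsplit : poch ((N : ℝ) + m) (m + r + 1 + 1) =
        poch ((N : ℝ) + m) (m + 1) * ((N + 2 * m + 1) * poch ((N : ℝ) + 2 * m + 2) r) := by
      rw [show m + r + 1 + 1 = m + 1 + (r + 1) by ring, poch_add, poch_succ_left _ r]
      push_cast
      ring_nf
    have hright := poch_succ ((N : ℝ) + m) (m + r + 1)
    have hleft := poch_succ_left ((N : ℝ) + m) (m + r + 1)
    rw [show m + r + 1 - (m + 1) = r by omega, Nat.choose_succ_succ]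
    push_cast at hright ⊢
    rw [show (N : ℝ) + (m + 1) - 1 = N + m by ring,
      show (N : ℝ) + 2 * (m + 1) = N + 2 * m + 2 by ring,
      show (N : ℝ) + (m + 1) = N + m + 1 by ring]
    have hA := poch_pos hx (m + 1)
    have hB := poch_pos (show (0 : ℝ) < N + 2 * m + 2 by positivity) r
    have hC := poch_pos hx (m + r + 1)
    have hD := poch_pos (show (0 : ℝ) < N + m + 1 by positivity) (m + r + 1)
    have hP := poch_pos hx (m + r + 1 + 1)
    generalize poch ((N : ℝ) + m) (m + r + 1 + 1) = P at *
    generalize poch ((N : ℝ) + m) (m + 1) = A at *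
    generalize poch ((N : ℝ) + 2 * m + 2) r = B at *
    generalize poch ((N : ℝ) + m) (m + r + 1) = C at *
    generalize poch ((N : ℝ) + m + 1) (m + r + 1) = D at *
    have hC' : C⁻¹ = (N + m + (m + r + 1)) / P := by
      rw [hright]; field_simp
    have hD' : D⁻¹ = (N + m) / P := by
      rw [hleft]; field_simp
    have hAB : (A * B)⁻¹ = (N + 2 * m + 1) / P := by
      rw [hsplit]; field_simp
    rw [div_eq_mul_inv _ C, div_eq_mul_inv _ D, div_eq_mul_inv _ (A * B), hC', hD', hAB]
    linear_combination (-(-1 : ℝ) ^ m / P) * hchoose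

theorem stmt6 (N : ℕ) (hN : 1 ≤ N) (p : ℕ) :
    ∑ n ∈ Finset.range (p + 1),
      (-1 : ℝ) ^ n * (Nat.choose p n : ℝ) /
        (poch ((N : ℝ) + n - 1) n * poch ((N : ℝ) + 2 * n) (p - n)) =
      if p = 0 then 1 else 0 := by
  cases p with
  | zero => simp [poch]
  | succ q =>
    rw [sum_range_alternating_choose_div_poch N hN q (q + 1) le_rfl]
    simp
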